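/- There exist a constant c > 0 and a natural number k₀ such that for every k ≥ k₀, every unsatisfiable linear k-CNF formula F has at least c·k·2^k clauses. Equivalently, writing f(k) for the minimum number of clauses in an unsatisfiable linear k-CNF, f(k) ∈ Ω(k·2^k). -/

import Mathlib

/-- A clause: a finite set of literals, where a literal is a pair of a variable
and a sign (`true` = positive occurrence, `false` = negated occurrence). -/
abbrev Clause (V : Type) : Type := Finset (V × Bool)

/-- A CNF formula: a finite set of clauses. -/
abbrev CNF (V : Type) : Type := Finset (Finset (V × Bool))

/-- The set of variables occurring (possibly negated) in a clause. -/
def vbl {V : Type} [DecidableEq V] (C : Clause V) : Finset V := C.image Prod.fst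

/-- A clause is proper if it does not contain both a variable and its negation. -/
def ProperClause {V : Type} (C : Clause V) : Prop :=
  ∀ x : V, ¬ ((x, true) ∈ C ∧ (x, false) ∈ C)

/-- The literal `(x, b)` evaluates to true under `α` iff `α x = b`;
an assignment satisfies a clause if some literal evaluates to true. -/
def SatClause {V : Type} (α : V → Bool) (C : Clause V) : Prop :=
  ∃ l ∈ C, α l.1 = l.2

instance {V : Type} [DecidableEq V] (α : V → Bool) (C : Clause V) :
    Decidable (SatClause α C) := by unfold SatClause; infer_instance

/-- An assignment satisfies a formula if it satisfies every clause. -/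
def Satisfies {V : Type} (α : V → Bool) (F : CNF V) : Prop :=
  ∀ C ∈ F, SatClause α C

/-- A formula is unsatisfiable if no assignment satisfies it. -/
def Unsat {V : Type} (F : CNF V) : Prop := ∀ α : V → Bool, ¬ Satisfies α F

/-- A `k`-CNF: every clause is proper and has exactly `k` literals. -/
def IsKCNF {V : Type} (k : ℕ) (F : CNF V) : Prop :=
  ∀ C ∈ F, ProperClause C ∧ C.card = k

/-- A CNF is linear if any two distinct clauses share at most one variable. -/
def LinearCNF {V : Type} [DecidableEq V] (F : CNF V) : Prop :=
  ∀ C ∈ F, ∀ D ∈ F, C ≠ D → (vbl C ∩ vbl D).card ≤ 1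

/-- The assignment whose set of true variables is `A`. -/
def indicatorAssignment {V : Type} [DecidableEq V] (A : Finset V) (x : V) : Bool :=
  decide (x ∈ A)

/-- The assignments, given as sets of true variables within `U`, that satisfy every clause
`c i` with `i ∈ G`. -/
def satSets {V ι : Type} [DecidableEq V] (U : Finset V) (c : ι → Clause V) (G : Finset ι) :
    Finset (Finset V) :=
  U.powerset.filter fun A => ∀ i ∈ G, SatClause (indicatorAssignment A) (c i)

/-- The members of `satSets U c G` that falsify the clause `C`. -/
def falsifyingSets {V ι : Type} [DecidableEq V] (U : Finset V) (c : ι → Clause V) (G : Finset ι)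
    (C : Clause V) : Finset (Finset V) :=
  (satSets U c G).filter fun A => ¬ SatClause (indicatorAssignment A) C

section LocalLemma

variable {V ι : Type} [DecidableEq V]

lemma mem_vbl_of_mem {C : Clause V} {l : V × Bool} (h : l ∈ C) : l.1 ∈ vbl C :=
  Finset.mem_image_of_mem _ h

lemma satClause_congr {α β : V → Bool} {C : Clause V} (h : ∀ x ∈ vbl C, α x = β x) :
    SatClause α C ↔ SatClause β C :=
  exists_congr fun l => and_congr_right fun hl => by rw [h l.1 (mem_vbl_of_mem hl)]

lemma eq_of_not_satClause {α β : V → Bool} {C : Clause V} (hα : ¬ SatClause α C)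
    (hβ : ¬ SatClause β C) {x : V} (hx : x ∈ vbl C) : α x = β x := by
  obtain ⟨l, hl, rfl⟩ := Finset.mem_image.1 hx
  have h1 : α l.1 ≠ l.2 := fun h => hα ⟨l, hl, h⟩
  have h2 : β l.1 ≠ l.2 := fun h => hβ ⟨l, hl, h⟩
  rw [Bool.eq_not.2 h1, Bool.eq_not.2 h2]

lemma two_pow_mul_card_falsifyingSets_le {U : Finset V} {c : ι → Clause V} {G : Finset ι}
    {C : Clause V} (hU : vbl C ⊆ U) (hG : ∀ j ∈ G, Disjoint (vbl (c j)) (vbl C)) :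
    2 ^ (vbl C).card * (falsifyingSets U c G C).card ≤ (satSets U c G).card := by
  rw [← Finset.card_powerset, ← Finset.card_product]
  refine Finset.card_le_card_of_injOn (fun p => (p.2 \ vbl C) ∪ p.1) ?_ ?_
  · rintro ⟨T, A⟩ hp
    simp only [Finset.coe_product, Set.mem_prod, Finset.mem_coe, Finset.mem_powerset,
      falsifyingSets, satSets, Finset.mem_filter] at hp ⊢
    obtain ⟨hT, ⟨hA, hs⟩, -⟩ := hp
    refine ⟨Finset.union_subset (Finset.sdiff_subset.trans hA) (hT.trans hU), fun j hj => ?_⟩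
    refine (satClause_congr fun x hx => ?_).1 (hs j hj)
    have hxC : x ∉ vbl C := Finset.disjoint_left.1 (hG j hj) hx
    have hxT : x ∉ T := fun h => hxC (hT h)
    simp [indicatorAssignment, hxC, hxT]
  · rintro ⟨T, A⟩ hp ⟨T', A'⟩ hp' he
    simp only [Finset.coe_product, Set.mem_prod, Finset.mem_coe, Finset.mem_powerset,
      falsifyingSets, Finset.mem_filter] at hp hp'
    have hag : ∀ x ∈ vbl C, (x ∈ A ↔ x ∈ A') := fun x hx => by
      simpa [indicatorAssignment] using eq_of_not_satClause hp.2.2 hp'.2.2 hx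
    have he' : ∀ x, ((x ∈ A ∧ x ∉ vbl C) ∨ x ∈ T ↔ (x ∈ A' ∧ x ∉ vbl C) ∨ x ∈ T') := fun x => by
      simpa using Finset.ext_iff.1 he x
    refine Prod.ext (Finset.ext fun x => ?_) (Finset.ext fun x => ?_)
    all_goals
      have h1 := he' x
      have h2 := @hp.1 x
      have h3 := @hp'.1 x
      have h4 := hag x
      dsimp only at *
      tauto

lemma satSets_anti {U : Finset V} {c : ι → Clause V} {G H : Finset ι} (h : H ⊆ G) :
    satSets U c G ⊆ satSets U c H :=
  Finset.monotone_filter_right _ fun _ _ hA i hi => hA i (h hi)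

lemma card_satSets_insert_add [DecidableEq ι] (U : Finset V) (c : ι → Clause V) (G : Finset ι)
    (i : ι) :
    (satSets U c (insert i G)).card + (falsifyingSets U c G (c i)).card
      = (satSets U c G).card := by
  rw [← Finset.card_filter_add_card_filter_not (s := satSets U c G)
    (fun A => SatClause (indicatorAssignment A) (c i)), falsifyingSets]
  congr 2
  ext A
  simp only [satSets, Finset.mem_filter, Finset.forall_mem_insert]
  tauto

lemma card_satSets_le_add_sum [DecidableEq ι] (U : Finset V) (c : ι → Clause V) {G H : Finset ι} :
    (satSets U c H).card ≤ (satSets U c G).card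
      + ∑ j ∈ G with j ∉ H, (falsifyingSets U c H (c j)).card := by
  classical
  have hsub : satSets U c H ⊆ satSets U c G ∪
      (G.filter (· ∉ H)).biUnion fun j => falsifyingSets U c H (c j) := by
    intro A hA
    by_cases h : ∀ j ∈ G, SatClause (indicatorAssignment A) (c j)
    · exact Finset.mem_union_left _
        (Finset.mem_filter.2 ⟨(Finset.mem_filter.1 hA).1, h⟩)
    · push Not at h
      obtain ⟨j, hj, hn⟩ := h
      have hjH : j ∉ H := fun hH => hn ((Finset.mem_filter.1 hA).2 j hH)
      exact Finset.mem_union_right _ (Finset.mem_biUnion.2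
        ⟨j, Finset.mem_filter.2 ⟨hj, hjH⟩, Finset.mem_filter.2 ⟨hA, hn⟩⟩)
  exact (Finset.card_le_card hsub).trans ((Finset.card_union_le _ _).trans
    (Nat.add_le_add_left Finset.card_biUnion_le _))

lemma two_pow_mul_card_falsifyingSets_le_two_mul [DecidableEq ι] {U : Finset V} {c : ι → Clause V}
    {S : Finset ι} {n : ℕ} (hU : ∀ i ∈ S, vbl (c i) ⊆ U) (hn : ∀ i ∈ S, (vbl (c i)).card = n)
    (hd : ∀ i ∈ S, 4 * (S.filter fun j => ¬ Disjoint (vbl (c j)) (vbl (c i))).card ≤ 2 ^ n)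
    (G : Finset ι) (hG : G ⊆ S) {i : ι} (hi : i ∈ S) :
    2 ^ n * (falsifyingSets U c G (c i)).card ≤ 2 * (satSets U c G).card := by
  induction G using Finset.strongInduction generalizing i with
  | H G ih =>
  set H := G.filter fun j => Disjoint (vbl (c j)) (vbl (c i)) with hH
  have hHG : H ⊆ G := Finset.filter_subset _ _
  have hind : 2 ^ n * (falsifyingSets U c H (c i)).card ≤ (satSets U c H).card := by
    rw [← hn i hi]
    exact two_pow_mul_card_falsifyingSets_le (hU i hi) fun j hj => (Finset.mem_filter.1 hj).2
  have hmono : (falsifyingSets U c G (c i)).card ≤ (falsifyingSets U c H (c i)).card :=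
    Finset.card_le_card (Finset.filter_subset_filter _ (satSets_anti hHG))
  have hmono' : 2 ^ n * (falsifyingSets U c G (c i)).card ≤ (satSets U c H).card :=
    (Nat.mul_le_mul_left _ hmono).trans hind
  rcases hHG.eq_or_ssubset with heq | hss
  · rw [heq] at hmono'
    omega
  have hsum := card_satSets_le_add_sum U c (G := G) (H := H)
  have hnb : 4 * (G.filter (· ∉ H)).card ≤ 2 ^ n := by
    refine le_trans (Nat.mul_le_mul_left _ (Finset.card_le_card fun j hj => ?_)) (hd i hi)
    simp only [hH, Finset.mem_filter, not_and] at hj ⊢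
    exact ⟨hG hj.1, hj.2 hj.1⟩
  have hbad : 2 ^ n * ∑ j ∈ G with j ∉ H, (falsifyingSets U c H (c j)).card
      ≤ (G.filter (· ∉ H)).card * (2 * (satSets U c H).card) := by
    rw [Finset.mul_sum, ← smul_eq_mul (G.filter (· ∉ H)).card]
    exact Finset.sum_le_card_nsmul _ _ _ fun j hj =>
      ih H hss (hHG.trans hG) (hG (Finset.mem_filter.1 hj).1)
  have hpos : 0 < 2 ^ n := by positivity
  have hhalf : 2 * ∑ j ∈ G with j ∉ H, (falsifyingSets U c H (c j)).card
      ≤ (satSets U c H).card := by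
    refine Nat.le_of_mul_le_mul_left ?_ hpos
    nlinarith [Nat.mul_le_mul_right (satSets U c H).card hnb]
  omega

/-- A symmetric Lovász local lemma for clauses. -/
theorem exists_satClause_of_card_neighbors_le {c : ι → Clause V} {S : Finset ι} {n : ℕ}
    (h2 : 2 ≤ n) (hn : ∀ i ∈ S, (vbl (c i)).card = n)
    (hd : ∀ i ∈ S, 4 * (S.filter fun j => ¬ Disjoint (vbl (c j)) (vbl (c i))).card ≤ 2 ^ n) :
    ∃ α : V → Bool, ∀ i ∈ S, SatClause α (c i) := by
  classical
  set U := S.biUnion fun i => vbl (c i)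
  have hU : ∀ i ∈ S, vbl (c i) ⊆ U := fun i hi =>
    Finset.subset_biUnion_of_mem (fun i => vbl (c i)) hi
  have hpos : ∀ G ⊆ S, 0 < (satSets U c G).card := by
    intro G
    induction G using Finset.induction_on with
    | empty => intro _; simp [satSets]
    | insert i G _ ih =>
      intro hG
      have hGS : G ⊆ S := (Finset.subset_insert i G).trans hG
      have hN := ih hGS
      have hb := two_pow_mul_card_falsifyingSets_le_two_mul hU hn hd G hGS
        (hG (Finset.mem_insert_self i G))
      have hadd := card_satSets_insert_add U c G i
      have h4 : 2 ^ 2 ≤ 2 ^ n := Nat.pow_le_pow_right (by norm_num) h2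
      have := Nat.mul_le_mul_right (falsifyingSets U c G (c i)).card h4
      omega
  obtain ⟨A, hA⟩ := Finset.card_pos.1 (hpos S subset_rfl)
  exact ⟨_, (Finset.mem_filter.1 hA).2⟩

end LocalLemma

section Linear

variable {V : Type} [DecidableEq V]

lemma ProperClause.card_vbl {C : Clause V} (h : ProperClause C) : (vbl C).card = C.card := by
  refine Finset.card_image_of_injOn ?_
  rintro ⟨x, a⟩ ha ⟨y, b⟩ hb (rfl : x = y)
  rcases a with _ | _ <;> rcases b with _ | _
  · rfl
  · exact absurd ⟨hb, ha⟩ (h x)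
  · exact absurd ⟨ha, hb⟩ (h x)
  · rfl

/-- The number of clauses of `F` in which the variable `x` occurs. -/
def varDegree (F : CNF V) (x : V) : ℕ := (F.filter fun C => x ∈ vbl C).card

lemma sum_varDegree_le {F : CNF V} {k : ℕ} (hF : ∀ C ∈ F, (vbl C).card = k) (X : Finset V) :
    ∑ x ∈ X, varDegree F x ≤ k * F.card := by
  have h := Finset.sum_card_bipartiteAbove_eq_sum_card_bipartiteBelow
    (s := X) (t := F) fun x C => x ∈ vbl C
  simp only [Finset.bipartiteAbove, Finset.bipartiteBelow] at h
  simp only [varDegree, h]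
  rw [mul_comm, ← smul_eq_mul]
  exact Finset.sum_le_card_nsmul _ _ _ fun C hC =>
    (Finset.card_le_card fun x hx => (Finset.mem_filter.1 hx).2).trans (hF C hC).le

lemma vbl_filter_ne (C : Clause V) (x : V) :
    vbl (C.filter fun l => l.1 ≠ x) = (vbl C).erase x := by
  ext y
  simp only [vbl, Finset.mem_image, Finset.mem_filter, Finset.mem_erase]
  constructor
  · rintro ⟨l, ⟨hl, hx⟩, rfl⟩
    exact ⟨hx, l, hl, rfl⟩
  · rintro ⟨hx, l, hl, rfl⟩
    exact ⟨l, ⟨hl, hx⟩, rfl⟩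

/-- Deleting a variable of maximal degree from every clause shows that the deleted variables
are too many and too frequent for a small formula. -/
lemma sq_card_le_of_linear {F : CNF V} {k : ℕ} (hF : ∀ C ∈ F, (vbl C).card = k)
    (hlin : LinearCNF F) {x : Clause V → V} (hx : ∀ C ∈ F, x C ∈ vbl C)
    (hmax : ∀ C ∈ F, ∀ y ∈ vbl C, varDegree F y ≤ varDegree F (x C)) (y : V) :
    (F.filter fun C => y ∈ (vbl C).erase (x C)).card ^ 2 ≤ k * F.card := by
  set D := F.filter fun C => y ∈ (vbl C).erase (x C) with hD
  have hmem : ∀ C ∈ D, C ∈ F ∧ y ≠ x C ∧ y ∈ vbl C := fun C hC => by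
    simpa [hD] using hC
  have hinj : Set.InjOn x D := by
    intro C hC C' hC' he
    by_contra hne
    obtain ⟨h1, h2, h3⟩ := hmem C hC
    obtain ⟨h1', -, h3'⟩ := hmem C' hC'
    have hsub : {y, x C} ⊆ vbl C ∩ vbl C' := by
      intro z hz
      rcases Finset.mem_insert.1 hz with rfl | hz
      · exact Finset.mem_inter.2 ⟨h3, h3'⟩
      · rw [Finset.mem_singleton.1 hz]
        exact Finset.mem_inter.2 ⟨hx C h1, he ▸ hx C' h1'⟩
    have := (Finset.card_le_card hsub).trans (hlin C h1 C' h1' hne)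
    rw [Finset.card_pair h2] at this
    omega
  have hdeg : D.card ≤ varDegree F y :=
    Finset.card_le_card fun C hC => Finset.mem_filter.2 ⟨(hmem C hC).1, (hmem C hC).2.2⟩
  calc D.card ^ 2 = (D.image x).card • D.card := by
        rw [Finset.card_image_of_injOn hinj, smul_eq_mul, sq]
    _ ≤ ∑ z ∈ D.image x, varDegree F z := by
        refine Finset.card_nsmul_le_sum _ _ _ fun z hz => ?_
        obtain ⟨C, hC, rfl⟩ := Finset.mem_image.1 hz
        exact hdeg.trans (hmax C (hmem C hC).1 y (hmem C hC).2.2)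
    _ ≤ k * F.card := sum_varDegree_le hF _

lemma four_pow_le_of_unsat_linear {F : CNF V} {k : ℕ} (hk : 3 ≤ k) (hF : IsKCNF k F)
    (hlin : LinearCNF F) (hun : Unsat F) : 4 ^ k ≤ 64 * k ^ 3 * F.card := by
  have hcard : ∀ C ∈ F, (vbl C).card = k := fun C hC => by
    rw [(hF C hC).1.card_vbl, (hF C hC).2]
  have hex : ∀ C : Clause V, ∃ x, C ∈ F →
      x ∈ vbl C ∧ ∀ y ∈ vbl C, varDegree F y ≤ varDegree F x := by
    intro C
    by_cases hC : C ∈ F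
    · have hne : (vbl C).Nonempty := Finset.card_pos.1 (by rw [hcard C hC]; omega)
      obtain ⟨x, h1, h2⟩ := Finset.exists_max_image (vbl C) (varDegree F) hne
      exact ⟨x, fun _ => ⟨h1, h2⟩⟩
    · obtain ⟨C', hC'⟩ : F.Nonempty := by
        rw [Finset.nonempty_iff_ne_empty]
        rintro rfl
        exact hun (fun _ => true) fun C hC => absurd hC (Finset.notMem_empty C)
      have hne : (vbl C').Nonempty := Finset.card_pos.1 (by rw [hcard C' hC']; omega)
      exact ⟨hne.choose, fun h => absurd h hC⟩
  choose x hx using hex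
  set c : Clause V → Clause V := fun C => C.filter fun l => l.1 ≠ x C with hc
  have hvbl : ∀ C, vbl (c C) = (vbl C).erase (x C) := fun C => vbl_filter_ne C (x C)
  have hcardc : ∀ C ∈ F, (vbl (c C)).card = k - 1 := fun C hC => by
    rw [hvbl, Finset.card_erase_of_mem (hx C hC).1, hcard C hC]
  obtain ⟨C, hC, hbig⟩ : ∃ C ∈ F,
      2 ^ (k - 1) < 4 * (F.filter fun D => ¬ Disjoint (vbl (c D)) (vbl (c C))).card := by
    by_contra! hsmall
    obtain ⟨α, hα⟩ := exists_satClause_of_card_neighbors_le (by omega) hcardc hsmall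
    refine hun α fun C hC => ?_
    obtain ⟨l, hl, h⟩ := hα C hC
    exact ⟨l, (Finset.mem_filter.1 hl).1, h⟩
  have hsum : (F.filter fun D => ¬ Disjoint (vbl (c D)) (vbl (c C))).card ≤
      ∑ y ∈ vbl (c C), (F.filter fun D => y ∈ vbl (c D)).card := by
    refine (Finset.card_le_card fun D hD => ?_).trans Finset.card_biUnion_le
    obtain ⟨h1, h2⟩ := Finset.mem_filter.1 hD
    obtain ⟨y, hy, hy'⟩ := Finset.not_disjoint_iff.1 h2
    exact Finset.mem_biUnion.2 ⟨y, hy', Finset.mem_filter.2 ⟨h1, hy⟩⟩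
  obtain ⟨y, -, hy⟩ : ∃ y ∈ vbl (c C),
      2 ^ (k - 1) < 4 * k * (F.filter fun D => y ∈ vbl (c D)).card := by
    by_contra! hsmall
    have h1 := Finset.sum_le_card_nsmul _ _ _ hsmall
    rw [← Finset.mul_sum, hcardc C hC, smul_eq_mul] at h1
    have h2 : k * 2 ^ (k - 1) < k * 2 ^ (k - 1) := by
      calc k * 2 ^ (k - 1)
          < k * (4 * (F.filter fun D => ¬ Disjoint (vbl (c D)) (vbl (c C))).card) :=
            Nat.mul_lt_mul_of_pos_left hbig (by omega)
        _ ≤ 4 * k * ∑ y ∈ vbl (c C), (F.filter fun D => y ∈ vbl (c D)).card := by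
            nlinarith [Nat.mul_le_mul_left k hsum]
        _ ≤ (k - 1) * 2 ^ (k - 1) := h1
        _ ≤ k * 2 ^ (k - 1) := Nat.mul_le_mul_right _ (by omega)
    exact lt_irrefl _ h2
  simp only [hvbl] at hy
  have hsq := sq_card_le_of_linear hcard hlin (fun C hC => (hx C hC).1)
    (fun C hC => (hx C hC).2) y
  set d := (F.filter fun D => y ∈ (vbl D).erase (x D)).card
  have h2k : 2 ^ k ≤ 8 * k * d := by
    have : 2 ^ k = 2 * 2 ^ (k - 1) := by
      rw [← pow_succ', Nat.sub_add_cancel (by omega)]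
    rw [this]
    linarith
  calc 4 ^ k = (2 ^ k) ^ 2 := by rw [← pow_mul, mul_comm, pow_mul]; norm_num
    _ ≤ (8 * k * d) ^ 2 := Nat.pow_le_pow_left h2k 2
    _ = 64 * k ^ 2 * d ^ 2 := by ring
    _ ≤ 64 * k ^ 2 * (k * F.card) := Nat.mul_le_mul_left _ hsq
    _ = 64 * k ^ 3 * F.card := by ring

end Linear

lemma pow_four_le_two_pow {k : ℕ} (hk : 16 ≤ k) : k ^ 4 ≤ 2 ^ k := by
  induction k, hk using Nat.le_induction with
  | base => norm_num
  | succ k hk ih =>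
    rw [pow_succ 2]
    have h1 : 16 * k ^ 3 ≤ k ^ 4 := by
      rw [pow_succ' k 3]; exact Nat.mul_le_mul_right _ hk
    have h2 : 16 * k ^ 2 ≤ k ^ 3 := by
      rw [pow_succ' k 2]; exact Nat.mul_le_mul_right _ hk
    have h3 : 16 * k ≤ k ^ 2 := by
      rw [pow_two]; exact Nat.mul_le_mul_right _ hk
    have : (k + 1) ^ 4 = k ^ 4 + 4 * k ^ 3 + 6 * k ^ 2 + 4 * k + 1 := by ring
    omega

/-- There exist a constant `c > 0` and a threshold `k₀` such that for
every `k ≥ k₀`, every unsatisfiable linear `k`-CNF formula has at least `c·k·2^k`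
clauses, i.e. `f(k) ∈ Ω(k·2^k)`. -/
theorem unsat_linear_kCNF_lower_bound :
    ∃ c : ℝ, 0 < c ∧ ∃ k₀ : ℕ, ∀ k : ℕ, k₀ ≤ k →
      ∀ (V : Type) [DecidableEq V] (F : CNF V),
        IsKCNF k F → LinearCNF F → Unsat F →
          c * k * 2 ^ k ≤ (F.card : ℝ) := by
  refine ⟨1 / 64, by norm_num, 16, fun k hk V _ F hF hlin hun => ?_⟩
  have h1 := four_pow_le_of_unsat_linear (by omega) hF hlin hun
  have h2 := pow_four_le_two_pow hk
  have h3 : k ^ 3 * (k * 2 ^ k) ≤ k ^ 3 * (64 * F.card) := by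
    calc k ^ 3 * (k * 2 ^ k) = k ^ 4 * 2 ^ k := by ring
      _ ≤ 2 ^ k * 2 ^ k := Nat.mul_le_mul_right _ h2
      _ = 4 ^ k := by rw [← mul_pow]; norm_num
      _ ≤ 64 * k ^ 3 * F.card := h1
      _ = k ^ 3 * (64 * F.card) := by ring
  have h4 : k * 2 ^ k ≤ 64 * F.card :=
    Nat.le_of_mul_le_mul_left h3 (by positivity)
  have h5 : (k : ℝ) * 2 ^ k ≤ 64 * F.card := by exact_mod_cast h4
  linarith
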